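/- Let n ≥ 4 be odd, n = 2k + 1, and let G = C_{2n}(2, n) be the cubic circulant graph on 2n vertices with connection set {2, n}. Then the edge ideal I(G) satisfies pd(I(G)) ≤ 3k + 1. -/

import Mathlib

/-- The faces of cardinality `m` of a simplicial complex, given as a finite
family of finite subsets of `Fin n`. -/
def cfaces {n : ℕ} (Δ : Finset (Finset (Fin n))) (m : ℕ) : Finset (Finset (Fin n)) :=
  Δ.filter (fun F => F.card = m)

/-- The coefficient of the face `G` in the simplicial boundary of the face `F`
(with respect to the linear order on the vertices `Fin n`). -/
noncomputable def bcoeff (K : Type*) [Field K] {n : ℕ} (F G : Finset (Fin n)) : K :=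
  ∑ v ∈ F, if F.erase v = G then (-1 : K) ^ (F.filter (fun w => w < v)).card else 0

/-- The simplicial boundary map from chains spanned by faces of cardinality `m+1`
to chains spanned by faces of cardinality `m` (so the augmentation map
corresponds to `m = 0`). -/
noncomputable def boundaryMap (K : Type*) [Field K] {n : ℕ}
    (Δ : Finset (Finset (Fin n))) (m : ℕ) :
    ({F // F ∈ cfaces Δ (m + 1)} → K) →ₗ[K] ({G // G ∈ cfaces Δ m} → K) :=
  LinearMap.pi fun G => ∑ F : {F // F ∈ cfaces Δ (m + 1)}, bcoeff K F.1 G.1 • LinearMap.proj F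

/-- The dimension over `K` of the `i`-th reduced simplicial homology of the
simplicial complex `Δ` (using the augmented chain complex, so that
`i = -1` is allowed). -/
noncomputable def reducedHomologyRank (K : Type*) [Field K] {n : ℕ}
    (Δ : Finset (Finset (Fin n))) (i : ℤ) : ℕ :=
  if i = -1 then
    Module.finrank K (({F // F ∈ cfaces Δ 0} → K) ⧸ LinearMap.range (boundaryMap K Δ 0))
  else if 0 ≤ i then
    Module.finrank K
      (↥(LinearMap.ker (boundaryMap K Δ i.toNat)) ⧸
        Submodule.comap (LinearMap.ker (boundaryMap K Δ i.toNat)).subtype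
          (LinearMap.range (boundaryMap K Δ (i.toNat + 1))))
  else 0

/-- The graded Betti numbers `β_{i,j}` of the Stanley–Reisner ideal of the
simplicial complex `Δ` over the field `K`, defined via Hochster's formula:
`β_{i,j} = ∑_{|W| = j} dim_K H̃_{j-i-2}(Δ_W; K)`. -/
noncomputable def bettiNumber (K : Type*) [Field K] {n : ℕ}
    (Δ : Finset (Finset (Fin n))) (i j : ℕ) : ℕ :=
  ∑ W ∈ Finset.powersetCard j (Finset.univ : Finset (Fin n)),
    reducedHomologyRank K (Δ.filter (fun F => F ⊆ W)) ((j : ℤ) - (i : ℤ) - 2)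

/-- The Castelnuovo–Mumford regularity `reg(I) = max { j - i | β_{i,j}(I) ≠ 0 }`
of the Stanley–Reisner ideal of `Δ` over `K`. -/
noncomputable def regSR (K : Type*) [Field K] {n : ℕ} (Δ : Finset (Finset (Fin n))) : ℕ :=
  sSup {d : ℕ | ∃ i j : ℕ, bettiNumber K Δ i j ≠ 0 ∧ (j : ℤ) - (i : ℤ) = d}

/-- The projective dimension `pd(I) = max { i | β_{i,j}(I) ≠ 0 for some j }`
of the Stanley–Reisner ideal of `Δ` over `K`. -/
noncomputable def pdSR (K : Type*) [Field K] {n : ℕ} (Δ : Finset (Finset (Fin n))) : ℕ :=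
  sSup {i : ℕ | ∃ j : ℕ, bettiNumber K Δ i j ≠ 0}

/-- The reduced Euler characteristic `χ̃(Δ) = ∑_{F ∈ Δ} (-1)^{|F| - 1}`
of a simplicial complex `Δ` (the alternating sum of the `f`-vector). -/
def eulerCharSR {n : ℕ} (Δ : Finset (Finset (Fin n))) : ℤ :=
  ∑ F ∈ Δ, (-1 : ℤ) ^ (F.card + 1)

/-- The circulant graph `C_n(S)`: the graph on the vertex set `ZMod n`
(identified with `{x_1, …, x_n}`) in which `x` and `y` are adjacent if and only
if they differ by `±s (mod n)` for some `s ∈ S`. -/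
def circulant (n : ℕ) (S : Set ℕ) : SimpleGraph (ZMod n) :=
  SimpleGraph.fromRel (fun x y => ∃ s ∈ S, y - x = (s : ZMod n))

/-- A graph is chordal if it has no induced cycle of length `m ≥ 4`.  Here an
induced `m`-cycle is an injection of the cycle `C_m = C_m(1)` whose image
induces exactly the cycle's adjacency. -/
def IsChordal {V : Type*} (G : SimpleGraph V) : Prop :=
  ∀ m : ℕ, 4 ≤ m → ¬ ∃ f : ZMod m → V, Function.Injective f ∧
    ∀ a b : ZMod m, G.Adj (f a) (f b) ↔ (circulant m {1}).Adj a b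

/-- A graph is claw-free if it has no induced subgraph isomorphic to the claw
`K_{1,3}`, i.e. there is no vertex adjacent to three pairwise non-adjacent
vertices. -/
def ClawFree {V : Type*} (G : SimpleGraph V) : Prop :=
  ¬ ∃ c x y z : V, x ≠ y ∧ x ≠ z ∧ y ≠ z ∧
    G.Adj c x ∧ G.Adj c y ∧ G.Adj c z ∧ ¬ G.Adj x y ∧ ¬ G.Adj x z ∧ ¬ G.Adj y z

open Classical in
/-- The independence complex `Ind(G)` of a finite simple graph `G`, recorded
as a simplicial complex on `Fin (card V)` via a fixed identification of the
vertices with `Fin (card V)`.  It is the Stanley–Reisner complex of the edge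
ideal `I(G)`. -/
noncomputable def indComplex {V : Type*} [Fintype V] (G : SimpleGraph V) :
    Finset (Finset (Fin (Fintype.card V))) :=
  Finset.univ.filter (fun F : Finset (Fin (Fintype.card V)) =>
    ∀ u ∈ F, ∀ v ∈ F,
      ¬ G.Adj ((Fintype.equivFin V).symm u) ((Fintype.equivFin V).symm v))

/-- The Castelnuovo–Mumford regularity `reg(I(G))` of the edge ideal of the
finite simple graph `G` over the field `K`, computed (via Hochster's formula)
from the independence complex of `G`. -/
noncomputable def regEdgeIdeal (K : Type*) [Field K] {V : Type*} [Fintype V]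
    (G : SimpleGraph V) : ℕ :=
  regSR K (indComplex G)

/-- The projective dimension `pd(I(G))` of the edge ideal of the finite simple
graph `G` over the field `K`, computed (via Hochster's formula) from the
independence complex of `G`. -/
noncomputable def pdEdgeIdeal (K : Type*) [Field K] {V : Type*} [Fintype V]
    (G : SimpleGraph V) : ℕ :=
  pdSR K (indComplex G)

/-- The sign with which the vertex `v` enters the face `insert v F`. -/
def vertexSign (K : Type*) [Field K] {N : ℕ} (v : Fin N) (F : Finset (Fin N)) : K :=
  (-1) ^ (F.filter (fun w => w < v)).card

/-- The simplicial boundary operator on all functions on finite subsets of `Fin N`. -/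
def totalBoundary {K : Type*} [Field K] {N : ℕ} (f : Finset (Fin N) → K)
    (G : Finset (Fin N)) : K :=
  ∑ v, if v ∈ G then 0 else vertexSign K v G * f (insert v G)

/-- The cone operator with apex `v`. -/
def coneMap {K : Type*} [Field K] {N : ℕ} (v : Fin N) (f : Finset (Fin N) → K)
    (F : Finset (Fin N)) : K :=
  if v ∈ F then vertexSign K v (F.erase v) * f (F.erase v) else 0

/-- The projection of a chain to the link of `v`. -/
def linkMap {K : Type*} [Field K] {N : ℕ} (v : Fin N) (f : Finset (Fin N) → K)
    (F : Finset (Fin N)) : K :=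
  if v ∈ F then 0 else vertexSign K v F * f (insert v F)

section Signs

variable {K : Type*} [Field K] {N : ℕ}

theorem vertexSign_mul_self (v : Fin N) (F : Finset (Fin N)) :
    vertexSign K v F * vertexSign K v F = 1 := by
  unfold vertexSign
  rw [← mul_pow]
  simp

theorem vertexSign_insert {v w : Fin N} {F : Finset (Fin N)} (hw : w ∉ F) :
    vertexSign K v (insert w F) = (if w < v then -1 else 1) * vertexSign K v F := by
  unfold vertexSign
  rw [Finset.filter_insert]
  split_ifs with h
  · rw [Finset.card_insert_of_notMem (by simp [hw]), pow_succ]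
    ring
  · simp

theorem vertexSign_swap {v w : Fin N} {F : Finset (Fin N)} (hvw : v ≠ w) (hv : v ∉ F)
    (hw : w ∉ F) :
    vertexSign K w (insert v F) * vertexSign K v F =
      -(vertexSign K v (insert w F) * vertexSign K w F) := by
  rw [vertexSign_insert hv, vertexSign_insert hw]
  rcases lt_or_gt_of_ne hvw with h | h
  · simp [h, h.not_gt]; ring
  · simp [h, h.not_gt]; ring

theorem totalBoundary_add (f g : Finset (Fin N) → K) :
    totalBoundary (f + g) = totalBoundary f + totalBoundary g := by
  ext G
  simp only [totalBoundary, Pi.add_apply, ← Finset.sum_add_distrib]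
  refine Finset.sum_congr rfl fun v _ => ?_
  split_ifs <;> ring

theorem totalBoundary_sub (f g : Finset (Fin N) → K) :
    totalBoundary (f - g) = totalBoundary f - totalBoundary g := by
  ext G
  simp only [totalBoundary, Pi.sub_apply, ← Finset.sum_sub_distrib]
  refine Finset.sum_congr rfl fun v _ => ?_
  split_ifs <;> ring

theorem coneMap_zero (v : Fin N) : coneMap v (0 : Finset (Fin N) → K) = 0 := by
  ext F
  simp [coneMap]

/-- The cone operator is a contracting homotopy. -/
theorem totalBoundary_coneMap (v : Fin N) (f : Finset (Fin N) → K) :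
    totalBoundary (coneMap v f) = f - coneMap v (totalBoundary f) := by
  ext G
  by_cases hv : v ∈ G
  · obtain ⟨F, hvF, rfl⟩ : ∃ F, v ∉ F ∧ insert v F = G :=
      ⟨G.erase v, by simp, Finset.insert_erase hv⟩
    simp only [totalBoundary, coneMap, Pi.sub_apply, hv, if_true, Finset.erase_insert hvF]
    rw [← Finset.add_sum_erase _ _ (Finset.mem_univ v),
      ← Finset.add_sum_erase _ (fun w => if w ∈ F then 0 else _) (Finset.mem_univ v)]
    simp only [Finset.mem_insert_self, if_true, hvF, if_false, mul_add, ← mul_assoc,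
      vertexSign_mul_self, one_mul, zero_add, Finset.mul_sum]
    rw [sub_add_cancel_left, ← Finset.sum_neg_distrib]
    refine Finset.sum_congr rfl fun w hw => ?_
    have hwv : w ≠ v := Finset.ne_of_mem_erase hw
    by_cases hwF : w ∈ F
    · simp [hwF]
    · have h1 : (insert w (insert v F)).erase v = insert w F := by
        rw [Finset.insert_comm, Finset.erase_insert (by simp [hvF, hwv.symm])]
      simp only [Finset.mem_insert, hwv, hwF, or_self, if_false, h1, true_or, or_true, if_true]
      have hs := vertexSign_swap (K := K) hwv.symm hvF hwF
      have h2 := vertexSign_mul_self (K := K) v F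
      have h3 := vertexSign_mul_self (K := K) v (insert w F)
      linear_combination f (insert w F) * (vertexSign K v F * vertexSign K v (insert w F) * hs -
        vertexSign K w (insert v F) * vertexSign K v (insert w F) * h2 -
        vertexSign K w F * vertexSign K v F * h3)
  · simp only [totalBoundary, coneMap, Pi.sub_apply, hv, if_false, sub_zero]
    rw [Finset.sum_eq_single v]
    · simp [hv, ← mul_assoc, vertexSign_mul_self]
    · intro w _ hwv
      simp [hv, hwv.symm]
    · simp

theorem totalBoundary_linkMap {v : Fin N} {f : Finset (Fin N) → K} (hf : totalBoundary f = 0) :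
    totalBoundary (linkMap v f) = 0 := by
  ext G
  by_cases hv : v ∈ G
  · simp [totalBoundary, linkMap, hv]
  · have h := congrFun hf (insert v G)
    have key : totalBoundary (linkMap v f) G =
        -(vertexSign K v G * totalBoundary f (insert v G)) := by
      simp only [totalBoundary, Finset.mul_sum, ← Finset.sum_neg_distrib]
      refine Finset.sum_congr rfl fun w _ => ?_
      by_cases hwv : w = v
      · simp [hwv, linkMap]
      by_cases hw : w ∈ G
      · simp [hw]
      have hs := vertexSign_swap (K := K) (Ne.symm hwv) hv hw
      simp only [hw, if_false, linkMap, Finset.mem_insert, hv, Ne.symm hwv, hwv, or_self]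
      rw [Finset.insert_comm v w G]
      linear_combination (f (insert w (insert v G))) * hs
    rw [key, h]
    simp

theorem coneMap_linkMap (v : Fin N) (f : Finset (Fin N) → K) (F : Finset (Fin N)) :
    coneMap v (linkMap v f) F = if v ∈ F then f F else 0 := by
  by_cases hv : v ∈ F
  · simp [coneMap, linkMap, hv, ← mul_assoc, vertexSign_mul_self, Finset.insert_erase]
  · simp [coneMap, hv]

theorem sum_bcoeff_mul (f : Finset (Fin N) → K) (G : Finset (Fin N)) :
    ∑ F, bcoeff K F G * f F = totalBoundary f G := by
  simp only [bcoeff, totalBoundary, Finset.sum_mul]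
  have h : ∀ F : Finset (Fin N), ∑ v ∈ F, (if F.erase v = G then
      (-1 : K) ^ (F.filter (fun w => w < v)).card else 0) * f F =
      ∑ v, if v ∉ G ∧ F = insert v G then vertexSign K v G * f F else 0 := by
    intro F
    rw [← Finset.sum_filter_add_sum_filter_not Finset.univ (· ∈ F),
      Finset.sum_eq_zero (s := Finset.univ.filter (· ∉ F)), add_zero]
    · refine Finset.sum_congr (by simp) fun v hv => ?_
      by_cases hG : F.erase v = G
      · subst hG
        have : (F.filter (fun w => w < v)) = (F.erase v).filter (fun w => w < v) := by
          ext w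
          simp only [Finset.mem_filter, Finset.mem_erase]
          exact ⟨fun h => ⟨⟨h.2.ne, h.1⟩, h.2⟩, fun h => ⟨h.1.2, h.2⟩⟩
        simp [Finset.insert_erase (Finset.mem_filter.1 hv).2, vertexSign, this]
      · rw [if_neg hG, if_neg, zero_mul]
        rintro ⟨h1, rfl⟩
        exact hG (Finset.erase_insert h1)
    · intro v hv
      rw [if_neg]
      rintro ⟨-, rfl⟩
      simp at hv
  simp only [h]
  rw [Finset.sum_comm]
  refine Finset.sum_congr rfl fun v _ => ?_
  by_cases hv : v ∈ G <;> simp [hv]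

end Signs

/-- Every cycle of `Δ` on faces of cardinality `c` is a boundary. -/
def IsAcyclicAt (K : Type*) [Field K] {N : ℕ} (Δ : Finset (Finset (Fin N))) (c : ℕ) : Prop :=
  ∀ f : Finset (Fin N) → K, (∀ F, f F ≠ 0 → F ∈ cfaces Δ c) → totalBoundary f = 0 →
    ∃ g : Finset (Fin N) → K, (∀ F, g F ≠ 0 → F ∈ cfaces Δ (c + 1)) ∧ totalBoundary g = f

section Rank

variable {K : Type*} [Field K] {N : ℕ} {Δ : Finset (Finset (Fin N))}

theorem boundaryMap_restrict (m : ℕ) {f : Finset (Fin N) → K}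
    (hf : ∀ F, f F ≠ 0 → F ∈ cfaces Δ (m + 1)) (G : {G // G ∈ cfaces Δ m}) :
    boundaryMap K Δ m (fun F => f F.1) G = totalBoundary f G.1 := by
  rw [← sum_bcoeff_mul]
  simp only [boundaryMap, LinearMap.pi_apply, LinearMap.sum_apply, LinearMap.smul_apply,
    LinearMap.proj_apply, smul_eq_mul]
  rw [Finset.sum_coe_sort (cfaces Δ (m + 1)) (fun F => bcoeff K F G.1 * f F)]
  refine Finset.sum_subset (Finset.subset_univ _) fun F _ hF => ?_
  rw [not_imp_comm.1 (hf F) hF, mul_zero]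

theorem exists_extension {c : ℕ} (x : {F // F ∈ cfaces Δ c} → K) :
    ∃ f : Finset (Fin N) → K, (∀ F, f F ≠ 0 → F ∈ cfaces Δ c) ∧ (fun F => f F.1) = x := by
  classical
  refine ⟨fun F => if h : F ∈ cfaces Δ c then x ⟨F, h⟩ else 0, fun F hF => ?_, ?_⟩
  · by_contra h
    simp [h] at hF
  · ext F
    simp [F.2]

theorem reducedHomologyRank_eq_zero (hΔ : IsLowerSet (Δ : Set (Finset (Fin N)))) {c : ℕ}
    (h : IsAcyclicAt K Δ c) : reducedHomologyRank K Δ ((c : ℤ) - 1) = 0 := by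
  have hrange : ∀ f : Finset (Fin N) → K, (∀ F, f F ≠ 0 → F ∈ cfaces Δ c) →
      totalBoundary f = 0 →
      (fun F : {F // F ∈ cfaces Δ c} => f F.1) ∈ LinearMap.range (boundaryMap K Δ c) := by
    intro f hf hf0
    obtain ⟨g, hg, hgf⟩ := h f hf hf0
    refine ⟨fun F => g F.1, ?_⟩
    ext G
    rw [boundaryMap_restrict c hg, hgf]
  have hcard : ∀ (f : Finset (Fin N) → K), (∀ F, f F ≠ 0 → F ∈ cfaces Δ c) →
      ∀ G : Finset (Fin N), (G.card + 1 ≠ c ∨ G ∉ Δ) → totalBoundary f G = 0 := by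
    intro f hf G hG
    refine Finset.sum_eq_zero fun v _ => ?_
    split_ifs with hv
    · rfl
    · by_contra hne
      have hm := hf _ (right_ne_zero_of_mul hne)
      rw [cfaces, Finset.mem_filter, Finset.card_insert_of_notMem hv] at hm
      exact hG.elim (fun h => h hm.2) (fun h => h (hΔ (Finset.subset_insert v G) hm.1))
  cases c with
  | zero =>
    simp only [reducedHomologyRank, Nat.cast_zero, zero_sub, if_true]
    have : LinearMap.range (boundaryMap K Δ 0) = ⊤ := by
      refine eq_top_iff.2 fun x _ => ?_
      obtain ⟨f, hf, rfl⟩ := exists_extension x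
      exact hrange f hf (funext fun G => hcard f hf G (Or.inl (by omega)))
    rw [this]
    exact Module.finrank_zero_of_subsingleton
  | succ m =>
    have h1 : ((m + 1 : ℕ) : ℤ) - 1 = m := by push_cast; ring
    rw [h1, reducedHomologyRank, if_neg (by omega), if_pos (by omega), Int.toNat_natCast]
    have : Submodule.comap (LinearMap.ker (boundaryMap K Δ m)).subtype
        (LinearMap.range (boundaryMap K Δ (m + 1))) = ⊤ := by
      refine eq_top_iff.2 fun x _ => ?_
      obtain ⟨x, hx⟩ := x
      obtain ⟨f, hf, rfl⟩ := exists_extension x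
      refine hrange f hf (funext fun G => ?_)
      by_cases hG : G.card + 1 ≠ m + 1 ∨ G ∉ Δ
      · exact hcard f hf G hG
      · push Not at hG
        have hGm : G ∈ cfaces Δ m := by
          rw [cfaces, Finset.mem_filter]
          exact ⟨hG.2, by omega⟩
        have := congrFun (LinearMap.mem_ker.1 hx) ⟨G, hGm⟩
        rwa [boundaryMap_restrict m hf] at this
    rw [this]
    exact Module.finrank_zero_of_subsingleton

end Rank

open Classical in
/-- The independence complex of the subgraph of `H` induced on `W`. -/
noncomputable def indFaces {N : ℕ} (H : SimpleGraph (Fin N)) (W : Finset (Fin N)) :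
    Finset (Finset (Fin N)) :=
  Finset.univ.filter (fun F => F ⊆ W ∧ ∀ u ∈ F, ∀ v ∈ F, ¬ H.Adj u v)

open Classical in
/-- The vertices of `V` outside the closed neighbourhood of `v`. -/
noncomputable def awayFrom {N : ℕ} (H : SimpleGraph (Fin N)) (V : Finset (Fin N)) (v : Fin N) :
    Finset (Fin N) :=
  V.filter (fun u => u ≠ v ∧ ¬ H.Adj v u)

/-- The combinatorial form, through Hochster's formula, of the assertion that the
Stanley–Reisner ring of the independence complex of `H[V]` has depth at least `m`. -/
def DepthGE (K : Type*) [Field K] {N : ℕ} (H : SimpleGraph (Fin N)) (V : Finset (Fin N))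
    (m : ℕ) : Prop :=
  ∀ W ⊆ V, ∀ c : ℕ, V.card + c < W.card + m → IsAcyclicAt K (indFaces H W) c

section Depth

variable {K : Type*} [Field K] {N : ℕ} {H : SimpleGraph (Fin N)} {V W : Finset (Fin N)}
  {v : Fin N}

theorem mem_cfaces_indFaces {c : ℕ} {F : Finset (Fin N)} :
    F ∈ cfaces (indFaces H W) c ↔
      (F ⊆ W ∧ ∀ u ∈ F, ∀ v ∈ F, ¬ H.Adj u v) ∧ F.card = c := by
  simp [cfaces, indFaces]

theorem mem_awayFrom {u : Fin N} : u ∈ awayFrom H V v ↔ u ∈ V ∧ u ≠ v ∧ ¬ H.Adj v u := by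
  simp [awayFrom]

theorem insert_mem_cfaces {c : ℕ} {F : Finset (Fin N)} (hv : v ∈ W)
    (hF : F ∈ cfaces (indFaces H (awayFrom H W v)) c) :
    insert v F ∈ cfaces (indFaces H W) (c + 1) := by
  rw [mem_cfaces_indFaces] at hF ⊢
  obtain ⟨⟨h1, h2⟩, h3⟩ := hF
  have h4 : ∀ u ∈ F, u ∈ W ∧ u ≠ v ∧ ¬ H.Adj v u := fun u hu => mem_awayFrom.1 (h1 hu)
  refine ⟨⟨?_, ?_⟩, ?_⟩
  · exact Finset.insert_subset hv fun u hu => (h4 u hu).1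
  · intro a ha b hb
    rcases Finset.mem_insert.1 ha with rfl | ha' <;> rcases Finset.mem_insert.1 hb with rfl | hb'
    · exact H.irrefl
    · exact (h4 b hb').2.2
    · exact fun h => (h4 a ha').2.2 h.symm
    · exact h2 a ha' b hb'
  · rw [Finset.card_insert_of_notMem fun h => (h4 v h).2.1 rfl, h3]

theorem mem_cfaces_awayFrom {c : ℕ} {F : Finset (Fin N)} (hv : v ∉ F)
    (hF : insert v F ∈ cfaces (indFaces H W) (c + 1)) :
    F ∈ cfaces (indFaces H (awayFrom H W v)) c := by
  rw [mem_cfaces_indFaces, Finset.card_insert_of_notMem hv] at hF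
  rw [mem_cfaces_indFaces]
  obtain ⟨⟨h1, h2⟩, h3⟩ := hF
  refine ⟨⟨fun u hu => ?_, fun a ha b hb => ?_⟩, by omega⟩
  · refine mem_awayFrom.2 ⟨h1 (by simp [hu]), fun h => hv (h ▸ hu), ?_⟩
    exact h2 v (by simp) u (by simp [hu])
  · exact h2 a (by simp [ha]) b (by simp [hb])

theorem support_coneMap {c : ℕ} (hv : v ∈ W) {f : Finset (Fin N) → K}
    (hf : ∀ F, f F ≠ 0 → F ∈ cfaces (indFaces H (awayFrom H W v)) c) (F : Finset (Fin N))
    (hF : coneMap v f F ≠ 0) : F ∈ cfaces (indFaces H W) (c + 1) := by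
  unfold coneMap at hF
  split_ifs at hF with h
  · have := insert_mem_cfaces hv (hf _ (right_ne_zero_of_mul hF))
    rwa [Finset.insert_erase h] at this
  · exact absurd rfl hF

theorem cfaces_mono {V : Finset (Fin N)} (h : V ⊆ W) {c : ℕ} {F : Finset (Fin N)}
    (hF : F ∈ cfaces (indFaces H V) c) : F ∈ cfaces (indFaces H W) c := by
  rw [mem_cfaces_indFaces] at hF ⊢
  exact ⟨⟨hF.1.1.trans h, hF.1.2⟩, hF.2⟩

theorem awayFrom_subset_erase : awayFrom H V v ⊆ V.erase v := fun u hu => by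
  rw [mem_awayFrom] at hu
  exact Finset.mem_erase.2 ⟨hu.2.1, hu.1⟩

/-- An exactness statement for deleting a vertex from an independence complex. -/
theorem isAcyclicAt_of_erase {c : ℕ} (hv : v ∈ W)
    (h1 : IsAcyclicAt K (indFaces H (W.erase v)) c)
    (h2 : ∀ b, c = b + 1 → IsAcyclicAt K (indFaces H (awayFrom H W v)) b) :
    IsAcyclicAt K (indFaces H W) c := by
  intro f hf hf0
  obtain ⟨g, hg, hgf⟩ : ∃ g : Finset (Fin N) → K,
      (∀ F, g F ≠ 0 → F ∈ cfaces (indFaces H (awayFrom H W v)) c) ∧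
        totalBoundary g = linkMap v f := by
    cases c with
    | zero =>
      refine ⟨0, by simp, ?_⟩
      ext F
      have : f (insert v F) = 0 := by
        by_contra h
        have := mem_cfaces_indFaces.1 (hf _ h)
        simp at this
      simp [totalBoundary, linkMap, this]
    | succ b =>
      refine h2 b rfl (linkMap v f) (fun F hF => ?_) (totalBoundary_linkMap hf0)
      unfold linkMap at hF
      split_ifs at hF with h
      · exact absurd rfl hF
      · exact mem_cfaces_awayFrom h (hf _ (right_ne_zero_of_mul hF))
  have hcone : totalBoundary (coneMap v (linkMap v f)) = linkMap v f := by
    rw [totalBoundary_coneMap, totalBoundary_linkMap hf0, coneMap_zero, sub_zero]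
  obtain ⟨e, he, hef⟩ := h1 (f - coneMap v (linkMap v f) + g) (fun F hF => by
      by_cases hg0 : g F = 0
      · by_cases hvF : v ∈ F
        · simp [coneMap_linkMap, hvF, hg0] at hF
        · simp only [Pi.add_apply, Pi.sub_apply, coneMap_linkMap, hvF, if_false, hg0, add_zero,
            sub_zero] at hF
          have := mem_cfaces_indFaces.1 (hf F hF)
          refine mem_cfaces_indFaces.2 ⟨⟨?_, this.1.2⟩, this.2⟩
          exact Finset.subset_erase.2 ⟨this.1.1, hvF⟩
      · exact cfaces_mono awayFrom_subset_erase (hg F hg0)) (by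
      rw [totalBoundary_add, totalBoundary_sub, hf0, hcone, hgf]
      simp)
  refine ⟨e - coneMap v g, fun F hF => ?_, ?_⟩
  · by_cases h : e F = 0
    · refine support_coneMap hv hg F fun h' => hF ?_
      simp [h, h']
    · exact cfaces_mono (Finset.erase_subset _ _) (he F h)
  · rw [totalBoundary_sub, hef, totalBoundary_coneMap, hgf]
    abel

/-- The independence complex of a graph with an isolated vertex is acyclic. -/
theorem isAcyclicAt_of_isolated (hv : v ∈ W) (h : ∀ u ∈ W, ¬ H.Adj v u) (c : ℕ) :
    IsAcyclicAt K (indFaces H W) c := by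
  intro f hf hf0
  refine ⟨coneMap v f, fun F hF => ?_, ?_⟩
  · unfold coneMap at hF
    split_ifs at hF with hvF
    · have h1 := mem_cfaces_indFaces.1 (hf _ (right_ne_zero_of_mul hF))
      have h2 : F.erase v ∈ cfaces (indFaces H (awayFrom H W v)) c := by
        refine mem_cfaces_indFaces.2 ⟨⟨fun u hu => mem_awayFrom.2 ?_, h1.1.2⟩, h1.2⟩
        exact ⟨h1.1.1 hu, Finset.ne_of_mem_erase hu, h u (h1.1.1 hu)⟩
      have := insert_mem_cfaces hv h2
      rwa [Finset.insert_erase hvF] at this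
    · exact absurd rfl hF
  · rw [totalBoundary_coneMap, hf0, coneMap_zero, sub_zero]

theorem depthGE_zero : DepthGE K H V 0 := fun W hW c h => by
  have := Finset.card_le_card hW
  omega

theorem DepthGE.mono {m m' : ℕ} (h : DepthGE K H V m) (hm : m' ≤ m) : DepthGE K H V m' :=
  fun W hW c hc => h W hW c (by omega)

theorem depthGE_of_erase {m : ℕ} (hv : v ∈ V) (h1 : DepthGE K H (V.erase v) (m + 1))
    (h2 : DepthGE K H (awayFrom H V v) m) : DepthGE K H V (m + 1) := by
  classical
  intro W hW c hc
  have hVc := Finset.card_erase_add_one hv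
  by_cases hvW : v ∈ W
  · have hWc := Finset.card_erase_add_one hvW
    refine isAcyclicAt_of_erase hvW (h1 _ (Finset.erase_subset_erase v hW) c (by omega)) ?_
    rintro b rfl
    refine h2 _ (Finset.filter_subset_filter _ hW) b ?_
    have e1 := Finset.card_filter_add_card_filter_not (s := V) (fun u => u ≠ v ∧ ¬ H.Adj v u)
    have e2 := Finset.card_filter_add_card_filter_not (s := W) (fun u => u ≠ v ∧ ¬ H.Adj v u)
    have e3 := Finset.card_le_card
      (Finset.filter_subset_filter (fun u => ¬ (u ≠ v ∧ ¬ H.Adj v u)) hW)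
    unfold awayFrom
    omega
  · exact h1 W (Finset.subset_erase.2 ⟨hW, hvW⟩) c (by omega)

theorem depthGE_of_isolated {m : ℕ} (hv : v ∈ V) (h : ∀ u ∈ V, ¬ H.Adj v u)
    (h1 : DepthGE K H (V.erase v) m) : DepthGE K H V (m + 1) := by
  intro W hW c hc
  by_cases hvW : v ∈ W
  · exact isAcyclicAt_of_isolated hvW (fun u hu => h u (hW hu)) c
  · have hVc := Finset.card_erase_add_one hv
    exact h1 W (Finset.subset_erase.2 ⟨hW, hvW⟩) c (by omega)

theorem depthGE_one (hV : V.Nonempty) : DepthGE K H V 1 := by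
  induction V using Finset.strongInduction with
  | H V ih =>
    obtain ⟨v, hv⟩ := hV
    by_cases h : ∀ u ∈ V, ¬ H.Adj v u
    · exact depthGE_of_isolated hv h depthGE_zero
    · push Not at h
      obtain ⟨u, hu, huv⟩ := h
      refine depthGE_of_erase hv (ih _ (Finset.erase_ssubset hv) ⟨u, ?_⟩) depthGE_zero
      exact Finset.mem_erase.2 ⟨huv.ne', hu⟩

theorem depthGE_of_pendant {m : ℕ} {u x : Fin N} (hu : u ∈ V) (hx : x ∈ V)
    (hadj : H.Adj u x) (h : ∀ y ∈ V, H.Adj u y → y = x)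
    (h1 : DepthGE K H ((V.erase x).erase u) m) (h2 : DepthGE K H (awayFrom H V x) m) :
    DepthGE K H V (m + 1) := by
  refine depthGE_of_erase hx (depthGE_of_isolated (Finset.mem_erase.2 ⟨hadj.ne, hu⟩) ?_ h1) h2
  intro y hy hadj'
  rw [Finset.mem_erase] at hy
  exact hy.1 (h y hy.2 hadj')

end Depth

/-- `p` parametrises the columns and rows of the prism over an `n`-cycle. -/
structure IsPrism {N : ℕ} (H : SimpleGraph (Fin N)) (n : ℕ) (p : ℤ → Bool → Fin N) : Prop where
  adj_iff : ∀ i ε y, H.Adj (p i ε) y ↔ y = p (i - 1) ε ∨ y = p (i + 1) ε ∨ y = p i (!ε)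
  inj : ∀ i j ε δ, p i ε = p j δ → |i - j| < n → i = j ∧ ε = δ

section Prism

variable {K : Type*} [Field K] {N : ℕ} {H : SimpleGraph (Fin N)} {V : Finset (Fin N)}
  {n : ℕ} {p : ℤ → Bool → Fin N}

theorem IsPrism.ne (hp : IsPrism H n p) {i j : ℤ} {ε δ : Bool} (hij : |i - j| < n)
    (h : i ≠ j ∨ ε ≠ δ) : p i ε ≠ p j δ := fun he => by
  have := hp.inj i j ε δ he hij
  tauto

theorem IsPrism.mem_awayFrom (hp : IsPrism H n p) {i j : ℤ} {ε δ : Bool} (hV : p j δ ∈ V)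
    (h0 : |j - i| < n) (h1 : |j - (i - 1)| < n) (h2 : |j - (i + 1)| < n)
    (h : (δ = ε → j < i - 1 ∨ i + 1 < j) ∧ (δ = !ε → j ≠ i)) :
    p j δ ∈ awayFrom H V (p i ε) := by
  rw [_root_.mem_awayFrom, hp.adj_iff]
  refine ⟨hV, hp.ne h0 ?_, ?_⟩
  · by_cases hδ : δ = ε
    · have := h.1 hδ
      left; omega
    · exact Or.inr hδ
  · rintro (he | he | he)
    · have := hp.inj _ _ _ _ he h1
      have := h.1 this.2
      omega
    · have := hp.inj _ _ _ _ he h2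
      have := h.1 this.2
      omega
    · have := hp.inj _ _ _ _ he h0
      exact h.2 this.2 this.1

theorem IsPrism.notMem_awayFrom (hp : IsPrism H n p) {i : ℤ} {ε : Bool} {y : Fin N}
    (h : y = p i ε ∨ y = p (i - 1) ε ∨ y = p (i + 1) ε ∨ y = p i (!ε)) :
    y ∉ awayFrom H V (p i ε) := by
  rw [_root_.mem_awayFrom, hp.adj_iff]
  tauto

/-- A set of vertices of a prism whose column `i` has a single vertex, with no neighbour in
the previous column, and which contains the following `s` columns, has depth at least
`s / 2 + 1`. -/
theorem IsPrism.depthGE_ladder (hp : IsPrism H n p) (s : ℕ) (hs : s + 1 < n) (i : ℤ) (ε : Bool)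
    (V : Finset (Fin N)) (h0 : p i ε ∈ V) (h1 : p i (!ε) ∉ V) (h2 : p (i - 1) ε ∉ V)
    (h3 : ∀ j : ℤ, ∀ δ, i < j → j ≤ i + s → p j δ ∈ V) : DepthGE K H V (s / 2 + 1) := by
  induction s using Nat.strong_induction_on generalizing i ε V with
  | h s ih =>
    by_cases hs2 : s < 2
    · rw [Nat.div_eq_of_lt hs2]
      exact depthGE_one ⟨_, h0⟩
    obtain ⟨t, rfl⟩ : ∃ t, s = t + 2 := ⟨s - 2, by omega⟩
    push_cast at h3
    refine depthGE_of_pendant h0 (h3 (i + 1) ε (by omega) (by omega)) ?_ ?_ ?_ ?_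
    · rw [hp.adj_iff]
      tauto
    · intro y hy hadj
      rw [hp.adj_iff] at hadj
      rcases hadj with rfl | h | rfl
      · exact absurd hy h2
      · exact h
      · exact absurd hy h1
    · refine (ih (t + 1) (by omega) (by omega) (i + 1) (!ε) _ ?_ ?_ ?_ ?_).mono (by omega)
      · simp only [Finset.mem_erase]
        refine ⟨hp.ne (by rw [abs_lt]; omega) (by simp),
          hp.ne (by rw [abs_lt]; omega) (by simp), h3 _ _ (by omega) (by omega)⟩
      · simp
      · simp [h1]
      · intro j δ hj1 hj2
        push_cast at hj2
        simp only [Finset.mem_erase]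
        refine ⟨hp.ne (by rw [abs_lt]; omega) (Or.inl (by omega)),
          hp.ne (by rw [abs_lt]; omega) (Or.inl (by omega)), h3 _ _ (by omega) (by omega)⟩
    · refine (ih t (by omega) (by omega) (i + 2) (!ε) _ ?_ ?_ ?_ ?_).mono (by omega)
      · refine hp.mem_awayFrom (h3 _ _ (by omega) (by omega)) (by rw [abs_lt]; omega)
          (by rw [abs_lt]; omega) (by rw [abs_lt]; omega) ?_
        simp
      · refine hp.notMem_awayFrom ?_
        rw [Bool.not_not, show i + 1 + 1 = i + 2 by ring]
        tauto
      · refine hp.notMem_awayFrom ?_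
        rw [show i + 2 - 1 = i + 1 by ring]
        tauto
      · intro j δ hj1 hj2
        refine hp.mem_awayFrom (h3 _ _ (by omega) (by omega)) (by rw [abs_lt]; omega)
          (by rw [abs_lt]; omega) (by rw [abs_lt]; omega) ?_
        exact ⟨fun _ => by omega, fun _ => by omega⟩

theorem IsPrism.depthGE_univ (hp : IsPrism H n p) {k : ℕ} (hk : n = 2 * k + 1) (hk2 : 2 ≤ k) :
    DepthGE K H Finset.univ k := by
  obtain ⟨l, rfl⟩ : ∃ l, k = l + 1 := ⟨k - 1, by omega⟩
  refine depthGE_of_erase (v := p 0 false) (Finset.mem_univ _) ?_ ?_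
  · have hmem : ∀ j : ℤ, ∀ δ, |j - 0| < n → (j ≠ 0 ∨ δ ≠ false) →
        p j δ ∈ Finset.univ.erase (p 0 false) := fun j δ hj h =>
      Finset.mem_erase.2 ⟨hp.ne hj h, Finset.mem_univ _⟩
    refine depthGE_of_erase (v := p 1 true) (hmem _ _ (by rw [abs_lt]; omega) (by simp)) ?_ ?_
    · refine (hp.depthGE_ladder (2 * l + 1) (by omega) 1 false _ ?_ ?_ ?_ ?_).mono (by omega)
      · exact Finset.mem_erase.2 ⟨hp.ne (by rw [abs_lt]; omega) (by simp),
          hmem _ _ (by rw [abs_lt]; omega) (by simp)⟩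
      · simp
      · simp
      · intro j δ hj1 hj2
        push_cast at hj2
        exact Finset.mem_erase.2 ⟨hp.ne (by rw [abs_lt]; omega) (Or.inl (by omega)),
          hmem _ _ (by rw [abs_lt]; omega) (Or.inl (by omega))⟩
    · refine (hp.depthGE_ladder (2 * l) (by omega) 2 false _ ?_ ?_ ?_ ?_).mono (by omega)
      · exact hp.mem_awayFrom (hmem _ _ (by rw [abs_lt]; omega) (by simp))
          (by rw [abs_lt]; omega) (by rw [abs_lt]; omega) (by rw [abs_lt]; omega) (by simp)
      · exact hp.notMem_awayFrom (by norm_num)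
      · exact hp.notMem_awayFrom (by norm_num)
      · intro j δ hj1 hj2
        push_cast at hj2
        exact hp.mem_awayFrom (hmem _ _ (by rw [abs_lt]; omega) (Or.inl (by omega)))
          (by rw [abs_lt]; omega) (by rw [abs_lt]; omega) (by rw [abs_lt]; omega)
          ⟨fun _ => by omega, fun _ => by omega⟩
  · refine (hp.depthGE_ladder (2 * l - 1) (by omega) 1 true _ ?_ ?_ ?_ ?_).mono (by omega)
    · exact hp.mem_awayFrom (Finset.mem_univ _)
        (by rw [abs_lt]; omega) (by rw [abs_lt]; omega) (by rw [abs_lt]; omega) (by simp)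
    · exact hp.notMem_awayFrom (by norm_num)
    · exact hp.notMem_awayFrom (by norm_num)
    · intro j δ hj1 hj2
      exact hp.mem_awayFrom (Finset.mem_univ _)
        (by rw [abs_lt]; omega) (by rw [abs_lt]; omega) (by rw [abs_lt]; omega)
        ⟨fun _ => by omega, fun _ => by omega⟩

end Prism

/-- The vertex of `C_{2n}(2, n)` in column `i` and in the row given by `ε`. -/
def prismVertex (n : ℕ) (i : ℤ) (ε : Bool) : ZMod (2 * n) :=
  ((2 * i + if ε then (n : ℤ) else 0 : ℤ) : ZMod (2 * n))

theorem prismVertex_inj {n k : ℕ} (hk : n = 2 * k + 1) {i j : ℤ} {ε δ : Bool}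
    (h : prismVertex n i ε = prismVertex n j δ) (hij : |i - j| < n) : i = j ∧ ε = δ := by
  unfold prismVertex at h
  rw [ZMod.intCast_eq_intCast_iff_dvd_sub] at h
  obtain ⟨c, hc⟩ := h
  push_cast at hc
  rw [mul_assoc] at hc
  have hεδ : ε = δ := by
    cases ε <;> cases δ <;> simp at hc ⊢ <;> omega
  subst hεδ
  refine ⟨?_, rfl⟩
  have h1 : j - i = n * c := by omega
  have h2 : (n : ℤ) ∣ i - j := ⟨-c, by linarith⟩
  have := Int.eq_zero_of_abs_lt_dvd h2 hij
  omega

theorem circulant_adj_prismVertex {n : ℕ} (hn : 3 ≤ n) (i : ℤ) (ε : Bool)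
    (y : ZMod (2 * n)) :
    (circulant (2 * n) {2, n}).Adj (prismVertex n i ε) y ↔
      y = prismVertex n (i - 1) ε ∨ y = prismVertex n (i + 1) ε ∨ y = prismVertex n i (!ε) := by
  have hnn : (n : ZMod (2 * n)) + n = 0 := by
    have := ZMod.natCast_self (2 * n)
    push_cast at this
    linear_combination this
  have h2 : ((2 : ℕ) : ZMod (2 * n)) ≠ 0 := by
    rw [Ne, ZMod.natCast_eq_zero_iff]
    intro h
    have := Nat.le_of_dvd (by norm_num) h
    omega
  have hn0 : (n : ZMod (2 * n)) ≠ 0 := by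
    rw [Ne, ZMod.natCast_eq_zero_iff]
    intro h
    have := Nat.le_of_dvd (by omega) h
    omega
  have e1 : prismVertex n (i - 1) ε = prismVertex n i ε - 2 := by
    unfold prismVertex; push_cast; ring
  have e2 : prismVertex n (i + 1) ε = prismVertex n i ε + 2 := by
    unfold prismVertex; push_cast; ring
  have e3 : prismVertex n i (!ε) = prismVertex n i ε + n := by
    unfold prismVertex
    cases ε <;> simp
    linear_combination -hnn
  rw [e1, e2, e3, circulant, SimpleGraph.fromRel_adj]
  generalize prismVertex n i ε = x
  simp only [Set.mem_insert_iff, Set.mem_singleton_iff, exists_eq_or_imp, exists_eq_left]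
  constructor
  · rintro ⟨-, (h | h) | (h | h)⟩
    · right; left; push_cast at h; linear_combination h
    · right; right; linear_combination h
    · left; push_cast at h; linear_combination -h
    · right; right; linear_combination -h - hnn
  · rintro (rfl | rfl | rfl)
    · refine ⟨fun h => h2 ?_, Or.inr (Or.inl ?_)⟩ <;> push_cast
      · linear_combination h
      · ring
    · refine ⟨fun h => h2 ?_, Or.inl (Or.inl ?_)⟩ <;> push_cast
      · linear_combination -h
      · ring
    · refine ⟨fun h => hn0 ?_, Or.inl (Or.inr ?_)⟩
      · linear_combination -h
      · ring

/-- Hochster's formula turns a depth bound into a bound on the projective dimension. -/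
theorem pdEdgeIdeal_le_of_depthGE {K : Type*} [Field K] {V : Type*} [Fintype V]
    {G : SimpleGraph V} {m b : ℕ} (hb : Fintype.card V ≤ b + 1 + m)
    (h : DepthGE K (G.comap (Fintype.equivFin V).symm) Finset.univ m) :
    pdEdgeIdeal K G ≤ b := by
  refine csSup_le' ?_
  rintro i ⟨j, hij⟩
  obtain ⟨W, hW, hne⟩ := Finset.exists_ne_zero_of_sum_ne_zero hij
  rw [Finset.mem_powersetCard] at hW
  have hfaces : (indComplex G).filter (fun F => F ⊆ W) =
      indFaces (G.comap (Fintype.equivFin V).symm) W := by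
    ext F
    simp [indComplex, indFaces, and_comm]
  rw [hfaces] at hne
  by_contra hi
  rcases lt_or_ge j (i + 1) with hj | hj
  · refine hne ?_
    rw [reducedHomologyRank, if_neg (by omega), if_neg (by omega)]
  · obtain ⟨c, rfl⟩ : ∃ c, j = i + 1 + c := ⟨j - (i + 1), by omega⟩
    refine hne ?_
    rw [show ((i + 1 + c : ℕ) : ℤ) - i - 2 = c - 1 by push_cast; ring]
    refine reducedHomologyRank_eq_zero ?_ (h W hW.1 c ?_)
    · intro F F' hle hF
      simp only [indFaces, Finset.coe_filter, Finset.mem_univ, true_and, Set.mem_ofPred_eq] at hF ⊢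
      exact ⟨hle.trans hF.1, fun u hu v hv => hF.2 u (hle hu) v (hle hv)⟩
    · rw [Finset.card_univ, Fintype.card_fin, hW.2]
      omega

/-- **Lemma 4.3(ii).**
Let `n ≥ 4` be odd, `n = 2k + 1`, and let `G = C_{2n}(2, n)` be the cubic
circulant graph on `2n` vertices with connection set `{2, n}`.  Then
`pd(I(G)) ≤ 3k + 1`. -/
theorem projective_dimension_bound_C2n_2_n
    (K : Type*) [Field K] (n : ℕ) [NeZero n] (hn : 4 ≤ n)
    (k : ℕ) (hk : n = 2 * k + 1) :
    pdEdgeIdeal K (circulant (2 * n) {2, n}) ≤ 3 * k + 1 := by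
  refine pdEdgeIdeal_le_of_depthGE (m := k) (by rw [ZMod.card]; omega) ?_
  let e := Fintype.equivFin (ZMod (2 * n))
  have hp : IsPrism ((circulant (2 * n) {2, n}).comap e.symm) n
      (fun i ε => e (prismVertex n i ε)) := by
    refine ⟨fun i ε y => ?_, fun i j ε δ h hij => prismVertex_inj hk (e.injective h) hij⟩
    rw [SimpleGraph.comap_adj, Equiv.symm_apply_apply,
      circulant_adj_prismVertex (by omega)]
    simp only [Equiv.symm_apply_eq]
  exact hp.depthGE_univ hk (by omega)
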